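/- arXiv:2110.15065 — 6 statements merged into one kernel-verified Lean document; each statement's English description precedes it below -/
import Mathlib

section
/- Let q = p^n be a power of an odd prime p. If A ⊆ 𝔽_q² has cardinality |A| ≥ 2·q^{3/2}, then there exist x ∈ A and z ∈ 𝔽_q with z ≠ 0 such that x + (z, z²) ∈ A. -/
open Classical in
/-- The number of `z` with `x + (z, z²) ∈ A`. -/
noncomputable def parabolaCount {F : Type*} [Field F] [Fintype F] (A : Finset (F × F))
    (x : F × F) : ℕ :=
  (Finset.univ.filter fun z : F => x + (z, z ^ 2) ∈ A).card

open Classical in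
theorem sum_parabolaCount {F : Type*} [Field F] [Fintype F] (A : Finset (F × F)) :
    ∑ x, parabolaCount A x = Fintype.card F * A.card := by
  simp only [parabolaCount, Finset.card_filter]
  rw [Finset.sum_comm]
  have h (z : F) : ∑ x : F × F, (if x + (z, z ^ 2) ∈ A then 1 else 0) = A.card := by
    refine (Equiv.sum_comp (Equiv.addRight ((z, z ^ 2) : F × F))
      (fun y => if y ∈ A then 1 else 0)).trans ?_
    simp
  simp [h]

open Classical in
theorem sum_parabolaCount_sq_le {F : Type*} [Field F] [Fintype F] (h2 : (2 : F) ≠ 0)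
    (A : Finset (F × F)) :
    ∑ x, parabolaCount A x ^ 2 ≤ A.card * Fintype.card F + A.card ^ 2 := by
  set S := (Finset.univ : Finset (F × F)).sigma fun x =>
    (Finset.univ.filter fun z : F => x + (z, z ^ 2) ∈ A) ×ˢ
      (Finset.univ.filter fun z : F => x + (z, z ^ 2) ∈ A) with hS
  have hcard : ∑ x, parabolaCount A x ^ 2 = S.card := by
    simp [hS, parabolaCount, Finset.card_sigma, Finset.card_product, sq]
  rw [hcard, ← Finset.card_filter_add_card_filter_not (s := S) fun t => t.2.1 = t.2.2]
  refine add_le_add ?_ ?_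
  · rw [← Finset.card_univ, ← Finset.card_product]
    refine Finset.card_le_card_of_injOn
      (fun t => (t.1 + (t.2.1, t.2.1 ^ 2), t.2.1)) ?_ ?_
    · rintro ⟨x, z, w⟩ ht
      simp_all
    · rintro ⟨x, z, w⟩ ht ⟨y, z', w'⟩ ht' h
      simp only [Finset.coe_filter, Set.mem_ofPred_eq, Prod.mk.injEq] at ht ht' h
      obtain ⟨h, rfl⟩ := h
      obtain rfl := ht.2
      obtain rfl := ht'.2
      obtain rfl := add_right_cancel h
      rfl
  · rw [sq, ← Finset.card_product]
    refine Finset.card_le_card_of_injOn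
      (fun t => (t.1 + (t.2.1, t.2.1 ^ 2), t.1 + (t.2.2, t.2.2 ^ 2))) ?_ ?_
    · rintro ⟨x, z, w⟩ ht
      simp_all
    · rintro ⟨⟨x₁, x₂⟩, z, w⟩ ht ⟨⟨y₁, y₂⟩, z', w'⟩ ht' h
      simp only [Finset.coe_filter, Set.mem_ofPred_eq, Prod.mk.injEq, Prod.mk_add_mk] at ht ht' h
      obtain ⟨⟨h₁, h₃⟩, h₄, h₅⟩ := h
      have hd : z - w ≠ 0 := sub_ne_zero.2 ht.2
      have hsub : z - w = z' - w' := by linear_combination h₁ - h₄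
      have hadd : z + w = z' + w' := by
        apply mul_left_cancel₀ hd
        linear_combination h₃ - h₅ - (z' + w') * hsub
      have hz : z = z' := by
        apply mul_left_cancel₀ h2
        linear_combination hsub + hadd
      subst hz
      obtain rfl : w = w' := by linear_combination hadd
      obtain rfl := add_right_cancel h₁
      obtain rfl := add_right_cancel h₃
      rfl

/-- The second moment of `parabolaCount A` about its mean `|A| / q`. -/
theorem sum_parabolaCount_sub_sq_le {F : Type*} [Field F] [Fintype F] (h2 : (2 : F) ≠ 0)
    (A : Finset (F × F)) :
    ∑ x, ((parabolaCount A x : ℝ) - A.card / Fintype.card F) ^ 2 ≤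
      A.card * Fintype.card F := by
  have hq : (Fintype.card F : ℝ) ≠ 0 := by simp
  have h₁ : ∑ x, (parabolaCount A x : ℝ) = Fintype.card F * A.card := by
    exact_mod_cast sum_parabolaCount A
  have h₂ : ∑ x, (parabolaCount A x : ℝ) ^ 2 ≤ A.card * Fintype.card F + (A.card : ℝ) ^ 2 := by
    exact_mod_cast sum_parabolaCount_sq_le h2 A
  simp only [sub_sq, Finset.sum_add_distrib, Finset.sum_sub_distrib, ← Finset.sum_mul,
    ← Finset.mul_sum, h₁, Finset.sum_const, Finset.card_univ, Fintype.card_prod, nsmul_eq_mul]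
  push_cast
  field_simp
  linarith

/-- If `q = p^n` is a power of an odd prime and `A ⊆ 𝔽_q²` has `|A| ≥ 2·q^{3/2}`, then `A`
contains a pair `x, x + (z, z²)` with `z ≠ 0`. -/
theorem parabolic_sarkozy_finite_field (p n : ℕ) (hp : p.Prime) (hodd : Odd p)
    (F : Type*) [Field F] [Fintype F] (hcard : Fintype.card F = p ^ n)
    (A : Finset (F × F))
    (hA : 2 * (Fintype.card F : ℝ) ^ ((3 : ℝ) / 2) ≤ (A.card : ℝ)) :
    ∃ x ∈ A, ∃ z : F, z ≠ 0 ∧ x + (z, z ^ 2) ∈ A := by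
  classical
  by_contra! hne
  have h2 : (2 : F) ≠ 0 := by
    refine Ring.two_ne_zero fun h => ?_
    have heven := FiniteField.even_card_iff_char_two.1 h
    have := hodd.pow (n := n)
    rw [← hcard, Nat.odd_iff] at this
    omega
  have hcount (x) (hx : x ∈ A) : (parabolaCount A x : ℝ) = 1 := by
    have : (Finset.univ.filter fun z : F => x + (z, z ^ 2) ∈ A) = {0} := by
      ext z
      simp only [Finset.mem_filter, Finset.mem_univ, true_and, Finset.mem_singleton]
      refine ⟨fun h => by_contra fun hz => hne x hx z hz h, ?_⟩
      rintro rfl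
      simpa [Prod.mk_zero_zero] using hx
    simp [parabolaCount, this]
  have hsum := (Finset.sum_le_sum_of_subset_of_nonneg A.subset_univ
    fun x _ _ => sq_nonneg _).trans (sum_parabolaCount_sub_sq_le h2 A)
  rw [Finset.sum_congr rfl fun x hx => by rw [hcount x hx], Finset.sum_const,
    nsmul_eq_mul] at hsum
  have hq : (1 : ℝ) < Fintype.card F := by exact_mod_cast Fintype.one_lt_card
  generalize (Fintype.card F : ℝ) = q at *
  have hs : √q ^ 2 = q := Real.sq_sqrt (by linarith)
  have hs1 : 1 < √q := Real.lt_sqrt_of_sq_lt (by linarith)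
  have hpow : q ^ ((3 : ℝ) / 2) = q * √q := by
    rw [Real.sqrt_eq_rpow, ← Real.rpow_one_add' (by linarith) (by norm_num)]
    norm_num
  rw [hpow] at hA
  have hApos : (0 : ℝ) < A.card := by nlinarith
  have hle := le_of_mul_le_mul_left hsum hApos
  have hdiv : 2 * √q ≤ A.card / q := by
    rw [le_div_iff₀ (by linarith)]
    linarith
  nlinarith
end

section
/- Let K ⊂ ℝ² be compact, and let μ be a Radon probability measure with spt(μ) ⊆ K. Let ψ be a non-negative Schwartz function on ℝ², and let π be a nonzero finite Radon measure on ℝ² with spt(π) ⊆ {(z, z²) : z ∈ ℝ, z ≠ 0}. Assume that liminf_{δ→0} ∫ ((μ * ψ_δ) * π) dμ > 0. Then there exist x ∈ K and z ≠ 0 such that x + (z, z²) ∈ K. -/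
open MeasureTheory Filter

/-- The topological support of a Borel measure on `ℝ × ℝ`: the set of points all of whose
open neighbourhoods have positive measure. -/
def msupport (μ : Measure (ℝ × ℝ)) : Set (ℝ × ℝ) :=
  {x | ∀ U : Set (ℝ × ℝ), IsOpen U → x ∈ U → 0 < μ U}

theorem isClosed_msupport (μ : Measure (ℝ × ℝ)) : IsClosed (msupport μ) := by
  rw [← isOpen_compl_iff, isOpen_iff_forall_mem_open]
  intro x hx
  simp only [msupport, Set.mem_compl_iff, Set.mem_ofPred_eq, not_forall] at hx
  obtain ⟨U, hU, hxU, h⟩ := hx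
  exact ⟨U, fun y hy hyS => h (hyS U hU hy), hU, hxU⟩

theorem ae_mem_msupport (μ : Measure (ℝ × ℝ)) : ∀ᵐ x ∂μ, x ∈ msupport μ := by
  refine measure_null_of_locally_null _ fun x hx => ?_
  simp only [msupport, Set.mem_compl_iff, Set.mem_ofPred_eq, not_forall] at hx
  obtain ⟨U, hU, hxU, h⟩ := hx
  exact ⟨U, mem_nhdsWithin_of_mem_nhds (hU.mem_nhds hxU), by simpa using h⟩

/-- Away from a ball around the origin, the planar rescalings of a Schwartz function tend to zero
uniformly, at a linear rate. -/
theorem SchwartzMap.exists_norm_rescale_le (ψ : SchwartzMap (ℝ × ℝ) ℝ) {ε : ℝ} (hε : 0 < ε) :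
    ∃ C : ℝ, ∀ δ : ℝ, 0 < δ → ∀ v : ℝ × ℝ, ε ≤ ‖v‖ →
      ‖(δ ^ 2)⁻¹ * ψ (δ⁻¹ • v)‖ ≤ C * δ := by
  obtain ⟨C, hC⟩ := ψ.decay 3 0
  refine ⟨C / ε ^ 3, fun δ hδ v hv => ?_⟩
  have h := hC.2 (δ⁻¹ • v)
  rw [norm_iteratedFDeriv_zero, norm_smul, norm_inv, Real.norm_of_nonneg hδ.le] at h
  have hle : (δ⁻¹ * ε) ^ 3 * ‖ψ (δ⁻¹ • v)‖ ≤ C := le_trans (by gcongr) h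
  rw [norm_mul, norm_inv, norm_pow, Real.norm_of_nonneg hδ.le, div_mul_eq_mul_div,
    le_div_iff₀ (by positivity)]
  calc (δ ^ 2)⁻¹ * ‖ψ (δ⁻¹ • v)‖ * ε ^ 3
      = (δ⁻¹ * ε) ^ 3 * ‖ψ (δ⁻¹ • v)‖ * δ := by field_simp
    _ ≤ C * δ := by gcongr

/-- A compact set whose difference set misses a closed set stays at positive distance from it. -/
theorem IsCompact.exists_pos_le_norm_sub_sub {E : Type*} [SeminormedAddCommGroup E]
    {K S : Set E} (hK : IsCompact K)
    (hS : IsClosed S) (h : ∀ x ∈ K, ∀ y ∈ K, x - y ∉ S) :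
    ∃ ε : ℝ, 0 < ε ∧ ∀ x ∈ K, ∀ y ∈ K, ∀ w ∈ S, ε ≤ ‖x - y - w‖ := by
  have hD : IsCompact ((fun p : E × E => p.1 - p.2) '' K ×ˢ K) :=
    (hK.prod hK).image (by fun_prop)
  obtain ⟨ε, hε, hsub⟩ := hD.exists_thickening_subset_open hS.isOpen_compl (by
    rintro _ ⟨⟨x, y⟩, ⟨hx, hy⟩, rfl⟩
    exact h x hx y hy)
  refine ⟨ε, hε, fun x hx y hy w hw => ?_⟩
  by_contra! hlt
  refine hsub (Metric.mem_thickening_iff.2 ⟨x - y, ⟨(x, y), ⟨hx, hy⟩, rfl⟩, ?_⟩) hw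
  rwa [dist_comm, dist_eq_norm]

/-- If `μ` is a probability measure supported on a compact set `K ⊆ ℝ²`, `ψ` is a non-negative
Schwartz function, `π` is a nonzero finite measure supported on the punctured parabola, and
`liminf_{δ→0} ∫ (μ * ψ_δ) * π dμ > 0`, then `K` contains a pair `x, x + (z, z²)`, `z ≠ 0`. -/
theorem pair_of_liminf_pos (K : Set (ℝ × ℝ)) (hK : IsCompact K)
    (μ : Measure (ℝ × ℝ)) [IsProbabilityMeasure μ] (hμK : msupport μ ⊆ K)
    (ψ : SchwartzMap (ℝ × ℝ) ℝ) (hψ : ∀ x, 0 ≤ ψ x)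
    (π : Measure (ℝ × ℝ)) [IsFiniteMeasure π] (hπ0 : π ≠ 0)
    (hπ : msupport π ⊆ {v : ℝ × ℝ | ∃ z : ℝ, z ≠ 0 ∧ v = (z, z ^ 2)})
    (hliminf :
      0 < liminf
        (fun δ : ℝ =>
          ∫ x, (∫ w, (∫ y, (δ ^ 2)⁻¹ * ψ (δ⁻¹ • (x - y - w)) ∂μ) ∂π) ∂μ)
        (nhdsWithin 0 (Set.Ioi 0))) :
    ∃ x ∈ K, ∃ z : ℝ, z ≠ 0 ∧ x + (z, z ^ 2) ∈ K := by
  by_contra! hno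
  have hdiff : ∀ x ∈ K, ∀ y ∈ K, x - y ∉ msupport π := by
    intro x hx y hy hmem
    obtain ⟨z, hz, hxy⟩ := hπ hmem
    refine hno y hy z hz ?_
    rwa [← hxy, add_sub_cancel]
  obtain ⟨ε, hε, hdist⟩ := hK.exists_pos_le_norm_sub_sub (isClosed_msupport π) hdiff
  obtain ⟨C, hC⟩ := ψ.exists_norm_rescale_le hε
  have hμ : ∀ᵐ x ∂μ, x ∈ K := (ae_mem_msupport μ).mono fun _ hx => hμK hx
  have hbound : ∀ δ : ℝ, 0 < δ →
      ‖∫ x, (∫ w, (∫ y, (δ ^ 2)⁻¹ * ψ (δ⁻¹ • (x - y - w)) ∂μ) ∂π) ∂μ‖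
        ≤ C * δ * μ.real Set.univ * π.real Set.univ * μ.real Set.univ := by
    intro δ hδ
    refine norm_integral_le_of_norm_le_const (hμ.mono fun x hx => ?_)
    refine norm_integral_le_of_norm_le_const ((ae_mem_msupport π).mono fun w hw => ?_)
    exact norm_integral_le_of_norm_le_const
      (hμ.mono fun y hy => hC δ hδ _ (hdist x hx y hy w hw))
  have hlim : Tendsto (fun δ : ℝ =>
      ∫ x, (∫ w, (∫ y, (δ ^ 2)⁻¹ * ψ (δ⁻¹ • (x - y - w)) ∂μ) ∂π) ∂μ)
      (nhdsWithin 0 (Set.Ioi 0)) (nhds 0) := by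
    refine squeeze_zero_norm' (eventually_mem_nhdsWithin.mono fun δ hδ => hbound δ hδ) ?_
    refine tendsto_nhdsWithin_of_tendsto_nhds (Continuous.tendsto' (by fun_prop) _ _ (by simp))
  exact hliminf.ne' hlim.liminf_eq
end

section
/- Let C > 0, 0 ≤ s ≤ 2, and let μ be a Borel measure on ℝ² such that μ(B(x, r)) ≤ C·r^s for all Euclidean closed balls B(x, r), x ∈ ℝ², r > 0. Then there is an absolute constant C' > 0 such that μ(B_Π(x, r)) ≤ C'·C·r^{2s−1} for all x ∈ ℝ² and all 0 < r ≤ 1. -/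
open MeasureTheory

/-- The parabolic metric on `ℝ²`. -/
noncomputable def dPi (a b : ℝ × ℝ) : ℝ := max |a.1 - b.1| (Real.sqrt |a.2 - b.2|)

/-- The closed ball in the parabolic metric. -/
noncomputable def ballPi (x : ℝ × ℝ) (r : ℝ) : Set (ℝ × ℝ) := {y | dPi x y ≤ r}

/-- The Euclidean closed ball in `ℝ × ℝ`. -/
def eball (x : ℝ × ℝ) (r : ℝ) : Set (ℝ × ℝ) :=
  {y | Real.sqrt ((y.1 - x.1) ^ 2 + (y.2 - x.2) ^ 2) ≤ r}

/-- A parabolic ball of radius `r` is covered by about `1 / r` Euclidean balls of radius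
comparable to `r ^ 2`. -/
theorem ballPi_subset_iUnion_eball (x : ℝ × ℝ) {r : ℝ} (hr : 0 < r) :
    ballPi x r ⊆ ⋃ k ∈ Finset.range (⌊1 / r⌋₊ + 1),
      eball (x.1 - r + 2 * k * r ^ 2, x.2) (3 * r ^ 2) := by
  intro y hy
  obtain ⟨h₁, h₂⟩ := max_le_iff.1 (show dPi x y ≤ r from hy)
  rw [Real.sqrt_le_left hr.le] at h₂
  rw [abs_le] at h₁ h₂
  have hr2 : 0 < r ^ 2 := by positivity
  have h_nonneg : 0 ≤ (y.1 - x.1 + r) / (2 * r ^ 2) := div_nonneg (by linarith) (by positivity)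
  have h_le : (y.1 - x.1 + r) / (2 * r ^ 2) ≤ 1 / r := by
    rw [div_le_div_iff₀ (by positivity) hr]
    nlinarith
  have h_lower := Nat.floor_le h_nonneg
  have h_upper := Nat.lt_floor_add_one ((y.1 - x.1 + r) / (2 * r ^ 2))
  rw [le_div_iff₀ (by positivity)] at h_lower
  rw [div_lt_iff₀ (by positivity)] at h_upper
  refine Set.mem_iUnion₂.2 ⟨⌊(y.1 - x.1 + r) / (2 * r ^ 2)⌋₊,
    Finset.mem_range.2 (Nat.lt_succ_of_le (Nat.floor_le_floor h_le)), ?_⟩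
  refine (Real.sqrt_le_left (by positivity)).2 ?_
  have h_fst : (y.1 - (x.1 - r + 2 * ⌊(y.1 - x.1 + r) / (2 * r ^ 2)⌋₊ * r ^ 2)) ^ 2
      ≤ (2 * r ^ 2) ^ 2 := sq_le_sq' (by linarith) (by linarith)
  have h_snd : (y.2 - x.2) ^ 2 ≤ (r ^ 2) ^ 2 := sq_le_sq' (by linarith) (by linarith)
  nlinarith [sq_nonneg (r ^ 2)]

/-- A Euclidean `s`-Frostman measure is a parabolic `(2s-1)`-Frostman measure (up to an
absolute constant), for radii `0 < r ≤ 1`. -/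
theorem euclidean_frostman_to_parabolic :
    ∃ C' : ℝ, 0 < C' ∧
      ∀ (C s : ℝ), 0 < C → 0 ≤ s → s ≤ 2 →
        ∀ μ : Measure (ℝ × ℝ),
          (∀ (x : ℝ × ℝ) (r : ℝ), 0 < r → μ (eball x r) ≤ ENNReal.ofReal (C * r ^ s)) →
          ∀ (x : ℝ × ℝ) (r : ℝ), 0 < r → r ≤ 1 →
            μ (ballPi x r) ≤ ENNReal.ofReal (C' * C * r ^ (2 * s - 1)) := by
  refine ⟨18, by norm_num, fun C s hC _ hs2 μ hμ x r hr hr1 => ?_⟩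
  have h_num : ((⌊1 / r⌋₊ + 1 : ℕ) : ℝ) ≤ 2 / r := by
    have h_floor := Nat.floor_le (one_div_pos.2 hr).le
    have h_one := one_le_one_div hr hr1
    have h_two : 2 / r = 1 / r + 1 / r := by ring
    push_cast
    linarith
  have h_pow : (3 * r ^ 2) ^ s ≤ 9 * r ^ (2 * s) := by
    rw [Real.mul_rpow (by norm_num) (by positivity), Real.rpow_mul hr.le, Real.rpow_two]
    gcongr
    calc (3 : ℝ) ^ s ≤ 3 ^ (2 : ℝ) := Real.rpow_le_rpow_of_exponent_le (by norm_num) hs2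
      _ = 9 := by norm_num
  calc μ (ballPi x r)
      ≤ ∑ k ∈ Finset.range (⌊1 / r⌋₊ + 1),
          μ (eball (x.1 - r + 2 * k * r ^ 2, x.2) (3 * r ^ 2)) :=
        (measure_mono (ballPi_subset_iUnion_eball x hr)).trans (measure_biUnion_finset_le _ _)
    _ ≤ ∑ _k ∈ Finset.range (⌊1 / r⌋₊ + 1), ENNReal.ofReal (C * (3 * r ^ 2) ^ s) :=
        Finset.sum_le_sum fun k _ => hμ _ _ (by positivity)
    _ = ENNReal.ofReal ((⌊1 / r⌋₊ + 1 : ℕ) * (C * (3 * r ^ 2) ^ s)) := by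
        rw [Finset.sum_const, Finset.card_range, nsmul_eq_mul,
          ENNReal.ofReal_mul (Nat.cast_nonneg _), ENNReal.ofReal_natCast]
    _ ≤ ENNReal.ofReal (2 / r * (C * (9 * r ^ (2 * s)))) := by gcongr
    _ = ENNReal.ofReal (18 * C * r ^ (2 * s - 1)) := by
        rw [Real.rpow_sub_one hr.ne']
        congr 1
        ring
end

section
/- For every set K ⊆ ℝ², dim_H^Π K ≥ 2·dim_H K − 1, where dim_H denotes the Euclidean Hausdorff dimension and dim_H^Π denotes the Hausdorff dimension computed with respect to the parabolic metric d_Π. -/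
open MeasureTheory

/-- The diameter of a set with respect to the parabolic metric, valued in `ℝ≥0∞`. -/
noncomputable def diamPi (E : Set (ℝ × ℝ)) : ENNReal :=
  ⨆ x ∈ E, ⨆ y ∈ E, ENNReal.ofReal (dPi x y)

/-- The `s`-dimensional Hausdorff content with respect to the parabolic metric. -/
noncomputable def contentPi (s : ℝ) (K : Set (ℝ × ℝ)) : ENNReal :=
  ⨅ (E : ℕ → Set (ℝ × ℝ)) (_ : K ⊆ ⋃ i, E i), ∑' i, diamPi (E i) ^ s

/-- The Hausdorff dimension with respect to the parabolic metric: the supremum of the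
exponents `d` at which the parabolic `d`-dimensional Hausdorff content is nonzero. -/
noncomputable def dimHPi (K : Set (ℝ × ℝ)) : ENNReal :=
  ⨆ (d : NNReal) (_ : contentPi (d : ℝ) K ≠ 0), (d : ENNReal)

open Filter Topology

theorem dPi_le_of_diamPi_le {E : Set (ℝ × ℝ)} {r : ℝ} (hr : 0 ≤ r)
    (hE : diamPi E ≤ ENNReal.ofReal r) {p q : ℝ × ℝ} (hp : p ∈ E) (hq : q ∈ E) :
    dPi p q ≤ r := by
  refine (ENNReal.ofReal_le_ofReal_iff hr).1 (le_trans ?_ hE)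
  exact le_iSup₂_of_le p hp (le_iSup₂_of_le q hq le_rfl)

/-- A set of parabolic diameter `r` splits into at most `⌊2 / r⌋ + 1` pieces of Euclidean
diameter at most `r ^ 2`. -/
theorem exists_cover_ediam_le_sq {E : Set (ℝ × ℝ)} {r : ℝ} (hr : 0 ≤ r)
    (hE : diamPi E ≤ ENNReal.ofReal r) :
    ∃ t : Fin (⌊2 / r⌋₊ + 1) → Set (ℝ × ℝ), E ⊆ ⋃ j, t j ∧
      ∀ j, Metric.ediam (t j) ≤ ENNReal.ofReal (r ^ 2) := by
  rcases E.eq_empty_or_nonempty with rfl | ⟨a, ha⟩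
  · exact ⟨fun _ => ∅, by simp, by simp⟩
  have h1 : ∀ p ∈ E, ∀ q ∈ E, |p.1 - q.1| ≤ r := fun p hp q hq =>
    (le_max_left _ _).trans (dPi_le_of_diamPi_le hr hE hp hq)
  have h2 : ∀ p ∈ E, ∀ q ∈ E, |p.2 - q.2| ≤ r ^ 2 := fun p hp q hq =>
    (Real.sqrt_le_left hr).1 ((le_max_right _ _).trans (dPi_le_of_diamPi_le hr hE hp hq))
  refine ⟨fun j => {p ∈ E | ⌊(p.1 - a.1 + r) / r ^ 2⌋₊ = j}, fun p hp => ?_, fun j => ?_⟩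
  · have hlt : ⌊(p.1 - a.1 + r) / r ^ 2⌋₊ < ⌊2 / r⌋₊ + 1 := by
      refine Nat.lt_succ_of_le (Nat.floor_le_floor ?_)
      rcases hr.eq_or_lt with rfl | hr
      · simp
      rw [div_le_div_iff₀ (by positivity) hr]
      nlinarith [(abs_le.1 (h1 p hp a ha)).2, sq_nonneg r]
    exact Set.mem_iUnion.2 ⟨⟨_, hlt⟩, hp, rfl⟩
  · refine Metric.ediam_le fun p hp q hq => ?_
    rw [edist_dist]
    refine ENNReal.ofReal_le_ofReal ?_
    rw [Prod.dist_eq, Real.dist_eq, Real.dist_eq]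
    refine max_le ?_ (h2 p hp.1 q hq.1)
    rcases hr.eq_or_lt with rfl | hr
    · simpa using h1 p hp.1 q hq.1
    have hr2 : 0 < r ^ 2 := by positivity
    have bounds : ∀ x ∈ E, ⌊(x.1 - a.1 + r) / r ^ 2⌋₊ = j →
        (j : ℝ) * r ^ 2 ≤ x.1 - a.1 + r ∧ x.1 - a.1 + r < (j + 1) * r ^ 2 := by
      intro x hx hj
      have h0 : 0 ≤ (x.1 - a.1 + r) / r ^ 2 :=
        div_nonneg (by linarith [(abs_le.1 (h1 x hx a ha)).1]) hr2.le
      have := (Nat.floor_eq_iff h0).1 hj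
      exact ⟨(le_div_iff₀ hr2).1 this.1, (div_lt_iff₀ hr2).1 this.2⟩
    have hp' := bounds p hp.1 hp.2
    have hq' := bounds q hq.1 hq.2
    rw [abs_le]
    constructor <;> linarith

theorem card_mul_sq_rpow_le {r d : ℝ} (hr : 0 ≤ r) (hr1 : r ≤ 1) (hd : 0 < d) :
    ((⌊2 / r⌋₊ + 1 : ℕ) : ℝ) * (r ^ 2) ^ ((d + 1) / 2) ≤ 3 * r ^ d := by
  rcases hr.eq_or_lt with rfl | hr
  · rw [zero_pow two_ne_zero, Real.zero_rpow (by positivity), Real.zero_rpow hd.ne']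
    simp
  have hpow : (r ^ 2) ^ ((d + 1) / 2) = r ^ d * r := by
    rw [← Real.rpow_natCast, ← Real.rpow_mul hr.le,
      show ((2 : ℕ) : ℝ) * ((d + 1) / 2) = d + 1 by push_cast; ring, Real.rpow_add_one hr.ne']
  have hN : ((⌊2 / r⌋₊ + 1 : ℕ) : ℝ) * r ≤ 3 := by
    push_cast
    have := mul_le_mul_of_nonneg_right (Nat.floor_le (by positivity : 0 ≤ 2 / r)) hr.le
    rw [div_mul_cancel₀ _ hr.ne'] at this
    linarith
  rw [hpow]
  nlinarith [Real.rpow_pos_of_pos hr d]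

theorem exists_fin_cover_sum_ediam_rpow_le {E : Set (ℝ × ℝ)} {d : ℝ} (hd : 0 < d)
    (hE : diamPi E ≤ 1) :
    ∃ (N : ℕ) (t : Fin N → Set (ℝ × ℝ)), E ⊆ ⋃ j, t j ∧
      (∀ j, Metric.ediam (t j) ≤ diamPi E) ∧
      ∑ j, Metric.ediam (t j) ^ ((d + 1) / 2) ≤ 3 * diamPi E ^ d := by
  have htop : diamPi E ≠ ⊤ := ne_top_of_le_ne_top ENNReal.one_ne_top hE
  have hr : 0 ≤ (diamPi E).toReal := ENNReal.toReal_nonneg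
  have hr1 : (diamPi E).toReal ≤ 1 := ENNReal.toReal_le_of_le_ofReal zero_le_one (by simpa using hE)
  have hof : ENNReal.ofReal (diamPi E).toReal = diamPi E := ENNReal.ofReal_toReal htop
  generalize (diamPi E).toReal = r at hr hr1 hof
  obtain ⟨t, hcov, ht⟩ := exists_cover_ediam_le_sq hr hof.ge
  refine ⟨_, t, hcov, fun j => (ht j).trans ?_, ?_⟩
  · rw [← hof]
    exact ENNReal.ofReal_le_ofReal (by nlinarith)
  · calc ∑ j, Metric.ediam (t j) ^ ((d + 1) / 2)
        ≤ ∑ _j : Fin (⌊2 / r⌋₊ + 1), ENNReal.ofReal (r ^ 2) ^ ((d + 1) / 2) :=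
          Finset.sum_le_sum fun j _ => ENNReal.rpow_le_rpow (ht j) (by positivity)
      _ = ENNReal.ofReal (((⌊2 / r⌋₊ + 1 : ℕ) : ℝ) * (r ^ 2) ^ ((d + 1) / 2)) := by
          rw [Finset.sum_const, Finset.card_univ, Fintype.card_fin, nsmul_eq_mul,
            ENNReal.ofReal_mul (by positivity), ENNReal.ofReal_natCast,
            ENNReal.ofReal_rpow_of_nonneg (by positivity) (by positivity)]
      _ ≤ ENNReal.ofReal (3 * r ^ d) :=
          ENNReal.ofReal_le_ofReal (card_mul_sq_rpow_le hr hr1 hd)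
      _ = 3 * diamPi E ^ d := by
          rw [← hof, ENNReal.ofReal_mul (by norm_num), ENNReal.ofReal_rpow_of_nonneg hr hd.le]
          norm_num

theorem exists_countable_cover_of_contentPi_eq_zero {K : Set (ℝ × ℝ)} {d : ℝ} (hd : 0 < d)
    (hK : contentPi d K = 0) {ε : ENNReal} (hε : 0 < ε) (hε1 : ε ≤ 1) :
    ∃ (N : ℕ → ℕ) (t : (Σ i, Fin (N i)) → Set (ℝ × ℝ)), K ⊆ ⋃ j, t j ∧
      (∀ j, Metric.ediam (t j) ≤ ε ^ d⁻¹) ∧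
      ∑' j, Metric.ediam (t j) ^ ((d + 1) / 2) ≤ 3 * ε := by
  have hlt : contentPi d K < ε := hK ▸ hε
  simp only [contentPi, iInf_lt_iff] at hlt
  obtain ⟨E, hcov, hsum⟩ := hlt
  have hdiam : ∀ i, diamPi (E i) ≤ ε ^ d⁻¹ := fun i =>
    (ENNReal.le_rpow_inv_iff hd).2 ((ENNReal.le_tsum i).trans hsum.le)
  have hone : ε ^ d⁻¹ ≤ 1 := ENNReal.rpow_le_one hε1 (by positivity)
  choose N t ht htd hts using fun i =>
    exists_fin_cover_sum_ediam_rpow_le hd ((hdiam i).trans hone)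
  refine ⟨N, fun j => t j.1 j.2, fun p hp => ?_, fun j => (htd j.1 j.2).trans (hdiam j.1), ?_⟩
  · obtain ⟨i, hi⟩ := Set.mem_iUnion.1 (hcov hp)
    obtain ⟨j, hj⟩ := Set.mem_iUnion.1 (ht i hi)
    exact Set.mem_iUnion.2 ⟨⟨i, j⟩, hj⟩
  · rw [ENNReal.tsum_sigma']
    calc ∑' i, ∑' j, Metric.ediam (t i j) ^ ((d + 1) / 2)
        ≤ ∑' i, 3 * diamPi (E i) ^ d :=
          ENNReal.tsum_le_tsum fun i => by rw [tsum_fintype]; exact hts i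
      _ = 3 * ∑' i, diamPi (E i) ^ d := ENNReal.tsum_mul_left
      _ ≤ 3 * ε := by gcongr

theorem hausdorffMeasure_eq_zero_of_contentPi_eq_zero {K : Set (ℝ × ℝ)} {d : ℝ} (hd : 0 < d)
    (hK : contentPi d K = 0) : μH[(d + 1) / 2] K = 0 := by
  set ε : ℕ → ENNReal := fun n => ((n + 1 : ℕ) : ENNReal)⁻¹
  have hε0 : Tendsto ε atTop (𝓝 0) :=
    ENNReal.tendsto_inv_nat_nhds_zero.comp (tendsto_add_atTop_nat 1)
  choose N t hcov hdiam hsum using fun n =>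
    exists_countable_cover_of_contentPi_eq_zero hd hK (ε := ε n)
      (ENNReal.inv_pos.2 (ENNReal.natCast_ne_top _))
      (ENNReal.inv_le_one.2 (by exact_mod_cast Nat.succ_pos n))
  have hr : Tendsto (fun n => ε n ^ d⁻¹) atTop (𝓝 0) := by
    simpa [ENNReal.zero_rpow_of_pos (inv_pos.2 hd)] using hε0.ennrpow_const d⁻¹
  have h3 : Tendsto (fun n => 3 * ε n) atTop (𝓝 0) := by
    simpa using ENNReal.Tendsto.const_mul hε0 (Or.inr (by norm_num : (3 : ENNReal) ≠ ⊤))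
  refine le_antisymm ?_ zero_le
  calc μH[(d + 1) / 2] K
      ≤ liminf (fun n => ∑' j, Metric.ediam (t n j) ^ ((d + 1) / 2)) atTop :=
        Measure.hausdorffMeasure_le_liminf_tsum _ K _ hr t
          (Eventually.of_forall hdiam) (Eventually.of_forall hcov)
    _ ≤ liminf (fun n => 3 * ε n) atTop := liminf_le_liminf (Eventually.of_forall hsum)
    _ = 0 := h3.liminf_eq

/-- For every `K ⊆ ℝ²`, the parabolic Hausdorff dimension is at least
`2·dim_H K − 1`, where `dim_H` is the Euclidean Hausdorff dimension. -/
theorem dimHPi_ge (K : Set (ℝ × ℝ)) : 2 * dimH K - 1 ≤ dimHPi K := by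
  by_contra! h
  obtain ⟨d, hd, hd'⟩ := ENNReal.lt_iff_exists_nnreal_btwn.1 h
  have hd0 : 0 < d := by exact_mod_cast zero_le.trans_lt hd
  have hK : contentPi d K = 0 := by
    by_contra hne
    exact (le_iSup₂_of_le (f := fun (d : NNReal) (_ : contentPi (d : ℝ) K ≠ 0) => (d : ENNReal))
      d hne le_rfl).not_gt hd
  have hμ : μH[(((d + 1) / 2 : NNReal) : ℝ)] K = 0 := by
    simpa only [NNReal.coe_div, NNReal.coe_add, NNReal.coe_one, NNReal.coe_ofNat] using
      hausdorffMeasure_eq_zero_of_contentPi_eq_zero (NNReal.coe_pos.2 hd0) hK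
  have hdim : dimH K ≤ ((d + 1) / 2 : NNReal) :=
    dimH_le_of_hausdorffMeasure_ne_top (by rw [hμ]; exact ENNReal.zero_ne_top)
  refine hd'.not_ge (tsub_le_iff_right.2 ?_)
  calc 2 * dimH K ≤ 2 * (((d + 1) / 2 : NNReal) : ENNReal) := by gcongr
    _ = ((2 * ((d + 1) / 2) : NNReal) : ENNReal) := by push_cast; rfl
    _ = d + 1 := by rw [mul_div_cancel₀ _ two_ne_zero]; push_cast; rfl
end

section
/- For every T ∈ ℕ there exists ε = ε(T) > 0 such that the following holds with δ = (1/8)·2^{-3T}. Let s ∈ (3 − ε, 3], let K ⊆ ℝ², and let Q ∈ D be a parabolic dyadic rectangle with H^s_∞(K ∩ Q) ≥ (1 − δ)·ℓ(Q)^s. Then every parabolic dyadic rectangle Q' ⊆ Q with ℓ(Q') = 2^{-T}·ℓ(Q) satisfies H^s_∞(K ∩ Q') ≥ (1/2)·ℓ(Q')^s. -/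
/-- The parabolic dyadic rectangle of generation `j` indexed by `k, m ∈ ℤ`. -/
noncomputable def dyadicRect (j : ℕ) (k m : ℤ) : Set (ℝ × ℝ) :=
  Set.Ico ((k : ℝ) * 2⁻¹ ^ j) (((k : ℝ) + 1) * 2⁻¹ ^ j) ×ˢ
    Set.Ico ((m : ℝ) * 4⁻¹ ^ j) (((m : ℝ) + 1) * 4⁻¹ ^ j)

/-- The dyadic parabolic Hausdorff content. -/
noncomputable def dyadicContentPi (s : ℝ) (K : Set (ℝ × ℝ)) : ENNReal :=
  ⨅ (f : ℕ → ℕ × ℤ × ℤ)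
    (_ : K ⊆ ⋃ i, dyadicRect (f i).1 (f i).2.1 (f i).2.2),
      ∑' i, (ENNReal.ofReal ((2 : ℝ)⁻¹ ^ (f i).1)) ^ s

theorem mem_dyadicRect_iff {j : ℕ} {k m : ℤ} {p : ℝ × ℝ} :
    p ∈ dyadicRect j k m ↔ ⌊p.1 * 2 ^ j⌋ = k ∧ ⌊p.2 * 4 ^ j⌋ = m := by
  have h2 : (0 : ℝ) < 2 ^ j := by positivity
  have h4 : (0 : ℝ) < 4 ^ j := by positivity
  simp only [dyadicRect, Set.mem_prod, Set.mem_Ico, Int.floor_eq_iff, inv_pow,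
    ← div_eq_mul_inv, div_le_iff₀ h2, lt_div_iff₀ h2, div_le_iff₀ h4, lt_div_iff₀ h4]

theorem floor_mul_mem_Ico {x : ℝ} {a k : ℤ} (ha : 0 < a) (hx : ⌊x⌋ = k) :
    ⌊x * a⌋ ∈ Finset.Ico (k * a) ((k + 1) * a) := by
  have ha' : (0 : ℝ) < a := by exact_mod_cast ha
  rw [Int.floor_eq_iff] at hx
  rw [Finset.mem_Ico, Int.le_floor, Int.floor_lt]
  push_cast
  constructor <;> nlinarith

/-- The indices of the descendants of generation `j + T` of `dyadicRect j k m`. -/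
noncomputable def descendants (T : ℕ) (k m : ℤ) : Finset (ℤ × ℤ) :=
  Finset.Ico (k * 2 ^ T) ((k + 1) * 2 ^ T) ×ˢ Finset.Ico (m * 4 ^ T) ((m + 1) * 4 ^ T)

theorem card_descendants (T : ℕ) (k m : ℤ) : (descendants T k m).card = 8 ^ T := by
  have h (k a : ℤ) : (k + 1) * a - k * a = a := by ring
  have h2 : ((2 : ℤ) ^ T).toNat = 2 ^ T :=
    Int.toNat_pow_of_nonneg (by norm_num) T
  have h4 : ((4 : ℤ) ^ T).toNat = 4 ^ T :=
    Int.toNat_pow_of_nonneg (by norm_num) T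
  rw [descendants, Finset.card_product, Int.card_Ico, Int.card_Ico, h, h, h2, h4, ← mul_pow]
  norm_num

theorem index_mem_descendants {j T : ℕ} {k m : ℤ} {p : ℝ × ℝ} (hp : p ∈ dyadicRect j k m) :
    (⌊p.1 * 2 ^ (j + T)⌋, ⌊p.2 * 4 ^ (j + T)⌋) ∈ descendants T k m := by
  rw [mem_dyadicRect_iff] at hp
  have h1 := floor_mul_mem_Ico (a := 2 ^ T) (by positivity) hp.1
  have h2 := floor_mul_mem_Ico (a := 4 ^ T) (by positivity) hp.2
  push_cast at h1 h2
  rw [pow_add, pow_add, ← mul_assoc, ← mul_assoc]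
  exact Finset.mem_product.2 ⟨h1, h2⟩

theorem mem_descendants_of_subset {j T : ℕ} {k m k' m' : ℤ}
    (h : dyadicRect (j + T) k' m' ⊆ dyadicRect j k m) : (k', m') ∈ descendants T k m := by
  have hp : ((k' / 2 ^ (j + T), m' / 4 ^ (j + T)) : ℝ × ℝ) ∈ dyadicRect (j + T) k' m' := by
    simp [mem_dyadicRect_iff]
  have hd := index_mem_descendants (T := T) (h hp)
  rwa [(mem_dyadicRect_iff.1 hp).1, (mem_dyadicRect_iff.1 hp).2] at hd

/-- Adding finitely many dyadic rectangles of a fixed generation to a set `K` increases its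
content by at most the sum of their contributions. -/
theorem dyadicContentPi_le_card_mul_add {s : ℝ} {K L : Set (ℝ × ℝ)} (n : ℕ) (S : Finset (ℤ × ℤ))
    (h : L ⊆ K ∪ ⋃ q ∈ S, dyadicRect n q.1 q.2) :
    dyadicContentPi s L ≤ S.card * ENNReal.ofReal ((2 : ℝ)⁻¹ ^ n) ^ s + dyadicContentPi s K := by
  rw [dyadicContentPi.eq_def s K]
  simp only [ENNReal.add_iInf]
  refine le_iInf₂ fun f hf ↦ ?_
  obtain ⟨e⟩ : Nonempty (ℕ ≃ S ⊕ ℕ) := nonempty_equiv_of_countable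
  let g : S ⊕ ℕ → ℕ × ℤ × ℤ := Sum.elim (fun q ↦ (n, q.1)) f
  refine (iInf₂_le (g ∘ e) fun p hp ↦ ?_).trans_eq ?_
  · rcases h hp with hK | hS
    · obtain ⟨i, hi⟩ := Set.mem_iUnion.1 (hf hK)
      exact Set.mem_iUnion.2 ⟨e.symm (Sum.inr i), by simpa [g] using hi⟩
    · obtain ⟨q, hq, hpq⟩ := Set.mem_iUnion₂.1 hS
      exact Set.mem_iUnion.2 ⟨e.symm (Sum.inl ⟨q, hq⟩), by simpa [g] using hpq⟩
  · simp only [Function.comp_apply]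
    rw [e.tsum_eq fun i ↦ ENNReal.ofReal ((2 : ℝ)⁻¹ ^ (g i).1) ^ s,
      ENNReal.summable.tsum_sum ENNReal.summable]
    simp [g]

theorem exists_pos_two_rpow_mul_le (T : ℕ) {η : ℝ} (hη : 1 < η) :
    ∃ ε : ℝ, 0 < ε ∧ (2 : ℝ) ^ (T * ε) ≤ η := by
  have hc : Continuous fun ε : ℝ ↦ (2 : ℝ) ^ (T * ε) :=
    continuous_const.rpow (by fun_prop) fun _ ↦ Or.inl two_ne_zero
  have ht : ∀ᶠ ε : ℝ in nhds 0, (2 : ℝ) ^ (T * ε) < η :=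
    hc.continuousAt.eventually_lt continuousAt_const (by simpa using hη)
  obtain ⟨ε, h, hε⟩ :=
    ((ht.filter_mono nhdsWithin_le_nhds).and (self_mem_nhdsWithin (s := Set.Ioi 0))).exists
  exact ⟨ε, hε, h.le⟩

/-- If a dyadic rectangle `Q` carries at least a `(1 − δ)`-fraction of content (with
`δ = 2^{-3T}/8`), and `s` is close enough to `3`, then every generation-`T` descendant `Q'`
of `Q` carries at least half of its own full content. -/
theorem children_have_half_content (T : ℕ) :
    ∃ ε : ℝ, 0 < ε ∧
      ∀ s : ℝ, 3 - ε < s → s ≤ 3 →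
        ∀ K : Set (ℝ × ℝ), ∀ (j : ℕ) (k m : ℤ),
          ENNReal.ofReal ((1 - (1 / 8) * (2 : ℝ)⁻¹ ^ (3 * T)) * ((2 : ℝ)⁻¹ ^ j) ^ s) ≤
            dyadicContentPi s (K ∩ dyadicRect j k m) →
          ∀ (k' m' : ℤ),
            dyadicRect (j + T) k' m' ⊆ dyadicRect j k m →
            ENNReal.ofReal ((1 / 2) * ((2 : ℝ)⁻¹ ^ (j + T)) ^ s) ≤
              dyadicContentPi s (K ∩ dyadicRect (j + T) k' m') := by
  obtain ⟨a, ha⟩ : ∃ a : ℝ, a = 2⁻¹ ^ (3 * T) := ⟨_, rfl⟩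
  have ha0 : 0 < a := by rw [ha]; positivity
  have ha8 : 8 ^ T * a = 1 := by
    rw [ha, pow_mul, ← mul_pow]
    norm_num
  obtain ⟨ε, hε, hη⟩ := exists_pos_two_rpow_mul_le T (η := 1 + a / 4) (by linarith)
  refine ⟨ε, hε, fun s hs _ K j k m hK k' m' hsub ↦ ?_⟩
  rw [← ha] at hK
  have hmem := mem_descendants_of_subset hsub
  have hcov : K ∩ dyadicRect j k m ⊆ K ∩ dyadicRect (j + T) k' m' ∪
      ⋃ q ∈ (descendants T k m).erase (k', m'), dyadicRect (j + T) q.1 q.2 := by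
    rintro p ⟨hpK, hpQ⟩
    by_cases hp : p ∈ dyadicRect (j + T) k' m'
    · exact Or.inl ⟨hpK, hp⟩
    · refine Or.inr (Set.mem_iUnion₂.2 ⟨_, Finset.mem_erase.2 ⟨fun h ↦ hp ?_,
        index_mem_descendants hpQ⟩, mem_dyadicRect_iff.2 ⟨rfl, rfl⟩⟩)
      exact mem_dyadicRect_iff.2 (Prod.mk.inj h)
  have hle := hK.trans (dyadicContentPi_le_card_mul_add (s := s) _ _ hcov)
  rw [Finset.card_erase_of_mem hmem, card_descendants,
    ENNReal.ofReal_rpow_of_pos (by positivity), ← ENNReal.ofReal_natCast,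
    ← ENNReal.ofReal_mul (by positivity), ← tsub_le_iff_left,
    ← ENNReal.ofReal_sub _ (by positivity)] at hle
  refine (ENNReal.ofReal_le_ofReal ?_).trans hle
  have h8 : (1 : ℝ) ≤ 8 ^ T := one_le_pow₀ (by norm_num)
  rw [Nat.cast_sub (Nat.one_le_pow _ _ (by norm_num)), pow_add,
    Real.mul_rpow (by positivity) (by positivity)]
  push_cast
  set c : ℝ := ((2 : ℝ)⁻¹ ^ j) ^ s
  have hc : 0 ≤ c := by positivity
  have hb : ((2 : ℝ)⁻¹ ^ T) ^ s ≤ a * (1 + a / 4) := by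
    calc ((2 : ℝ)⁻¹ ^ T) ^ s = a * 2 ^ (T * (3 - s)) := by
          rw [ha, inv_pow, inv_pow, ← Real.rpow_natCast, ← Real.rpow_natCast,
            ← Real.rpow_neg zero_le_two, ← Real.rpow_neg zero_le_two,
            ← Real.rpow_mul zero_le_two, ← Real.rpow_add zero_lt_two]
          congr 1
          push_cast
          ring
      _ ≤ a * (1 + a / 4) := by
          gcongr
          refine (Real.rpow_le_rpow_of_exponent_le one_le_two ?_).trans hη
          gcongr
          linarith
  set b : ℝ := ((2 : ℝ)⁻¹ ^ T) ^ s
  have hkey : (8 ^ T - 1 / 2) * b ≤ 1 - 1 / 8 * a := by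
    calc (8 ^ T - 1 / 2) * b ≤ (8 ^ T - 1 / 2) * (a * (1 + a / 4)) := by
          gcongr
          linarith
      _ = (8 ^ T * a - a / 2) * (1 + a / 4) := by ring
      _ ≤ 1 - 1 / 8 * a := by
          rw [ha8]
          nlinarith
  linarith [mul_le_mul_of_nonneg_right hkey hc]
end

section
/- Let q = p^n be a power of an odd prime p, and let A ⊆ 𝔽_q² have cardinality |A| = α·q² for some 0 ≤ α ≤ 1. Then the number of triples (x, y, z) ∈ 𝔽_q³ such that both (x, y) ∈ A and (x + z, y + z²) ∈ A is at least (α − q^{-1/2})·α·q³. -/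
open Finset in
/-- The number of indices `z` with `x + γ z` in `A`, summed over all `x` in the group,
is `|ι| * |A|`. -/
lemma sum_card_translates {G ι : Type*} [AddCommGroup G] [Fintype G] [DecidableEq G]
    [Fintype ι] (γ : ι → G) (A : Finset G) :
    ∑ x, #{z | x + γ z ∈ A} = Fintype.card ι * #A := by
  simp only [card_filter]
  rw [sum_comm]
  have h (z : ι) : ∑ x, (if x + γ z ∈ A then 1 else 0) = #A := by
    refine (Equiv.sum_comp (Equiv.addRight (γ z)) (fun x => if x ∈ A then 1 else 0)).trans ?_
    simp
  simp [h]

open Finset in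
/-- Second moment bound: if off-diagonal differences of `γ` determine the pair they come from,
then `∑ₓ |{z | x + γ z ∈ A}|² ≤ |ι| |A| + |A|²`. -/
lemma sum_sq_card_translates_le {G ι : Type*} [AddCommGroup G] [Fintype G] [DecidableEq G]
    [Fintype ι] [DecidableEq ι] (γ : ι → G)
    (hγ : ∀ z w z' w', z ≠ w → z' ≠ w' → γ z - γ w = γ z' - γ w' → z = z' ∧ w = w')
    (A : Finset G) :
    ∑ x, #{z | x + γ z ∈ A} ^ 2 ≤ Fintype.card ι * #A + #A ^ 2 := by
  have hsplit (x : G) : #{z | x + γ z ∈ A} ^ 2 = #{z | x + γ z ∈ A} +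
      #{s : ι × ι | s.1 ≠ s.2 ∧ x + γ s.1 ∈ A ∧ x + γ s.2 ∈ A} := by
    have h : ({s : ι × ι | s.1 ≠ s.2 ∧ x + γ s.1 ∈ A ∧ x + γ s.2 ∈ A} : Finset (ι × ι)) =
        offDiag {z | x + γ z ∈ A} := by
      ext s
      simp only [mem_filter_univ, mem_offDiag]
      tauto
    rw [h, offDiag_card, sq]
    exact (Nat.add_sub_cancel' (Nat.le_mul_self _)).symm
  have hoff : ∑ x, #{s : ι × ι | s.1 ≠ s.2 ∧ x + γ s.1 ∈ A ∧ x + γ s.2 ∈ A} ≤ #A ^ 2 := by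
    rw [← card_sigma, sq, ← card_product]
    refine card_le_card_of_injOn (fun t => (t.1 + γ t.2.1, t.1 + γ t.2.2)) ?_ ?_
    · rintro ⟨x, z, w⟩ h
      simp only [coe_sigma, Set.mem_sigma_iff, coe_filter, Set.mem_ofPred_eq] at h
      simpa using h.2.2.2
    · rintro ⟨x, z, w⟩ h ⟨x', z', w'⟩ h' heq
      simp only [coe_sigma, Set.mem_sigma_iff, coe_filter, Set.mem_ofPred_eq] at h h'
      obtain ⟨h₁, h₂⟩ := Prod.mk.inj heq
      obtain ⟨rfl, rfl⟩ := hγ z w z' w' h.2.2.1 h'.2.2.1 (by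
        simpa using congrArg₂ (· - ·) h₁ h₂)
      obtain rfl : x = x' := add_right_cancel h₁
      rfl
  simp only [hsplit, sum_add_distrib, sum_card_translates]
  omega

/-- In odd characteristic, a nonzero-width chord of the parabola is determined by its
difference vector. -/
lemma parabola_sub_injective {F : Type*} [Field F] (h2 : (2 : F) ≠ 0) (z w z' w' : F)
    (hzw : z ≠ w)
    (h : ((z, z ^ 2) : F × F) - (w, w ^ 2) = (z', z' ^ 2) - (w', w' ^ 2)) :
    z = z' ∧ w = w' := by
  simp only [Prod.mk_sub_mk, Prod.mk.injEq] at h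
  obtain ⟨h₁, h₂⟩ := h
  have h₃ : z + w = z' + w' := by
    refine mul_left_cancel₀ (sub_ne_zero.2 hzw) ?_
    linear_combination h₂ - (z' + w') * h₁
  constructor <;> refine mul_left_cancel₀ h2 ?_
  · linear_combination h₃ + h₁
  · linear_combination h₃ - h₁

open Finset in
/-- The incidence count along a translate family with distinct off-diagonal differences deviates
from its expected value by at most the square root of its variance bound. -/
lemma sq_sum_card_translates_sub_le {G ι : Type*} [AddCommGroup G] [Fintype G] [DecidableEq G]
    [Fintype ι] [DecidableEq ι] (γ : ι → G)
    (hγ : ∀ z w z' w', z ≠ w → z' ≠ w' → γ z - γ w = γ z' - γ w' → z = z' ∧ w = w')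
    (A : Finset G) (α : ℝ) (hG : Fintype.card G = Fintype.card ι ^ 2)
    (hA : (#A : ℝ) = α * (Fintype.card ι : ℝ) ^ 2) :
    ((∑ x ∈ A, #{z | x + γ z ∈ A} : ℕ) - α ^ 2 * (Fintype.card ι : ℝ) ^ 3) ^ 2 ≤
      α ^ 2 * (Fintype.card ι : ℝ) ^ 5 := by
  set q : ℝ := (Fintype.card ι : ℝ)
  set u : G → ℝ := fun x => #{z | x + γ z ∈ A}
  have hsum : ∑ x, u x = q * #A := by
    simp only [u, q]
    exact_mod_cast sum_card_translates γ A
  have hsq : ∑ x, u x ^ 2 ≤ q * #A + (#A : ℝ) ^ 2 := by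
    simp only [u, q]
    exact_mod_cast sum_sq_card_translates_le γ hγ A
  have hGq : (Fintype.card G : ℝ) = q ^ 2 := by
    simp only [q]
    exact_mod_cast hG
  have hvar : ∑ x, (u x - α * q) ^ 2 ≤ α * q ^ 3 := by
    have : ∑ x, (u x - α * q) ^ 2 =
        ∑ x, u x ^ 2 - 2 * (α * q) * ∑ x, u x + q ^ 2 * (α * q) ^ 2 := by
      simp only [sub_sq, sum_add_distrib, sum_sub_distrib, mul_sum, sum_const, card_univ,
        nsmul_eq_mul, hGq]
      congr 2
      exact sum_congr rfl fun _ _ => by ring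
    rw [this, hsum]
    rw [hA] at hsq ⊢
    linarith
  have hdev : ((∑ x ∈ A, #{z | x + γ z ∈ A} : ℕ) : ℝ) - α ^ 2 * q ^ 3 =
      ∑ x ∈ A, (u x - α * q) := by
    rw [sum_sub_distrib, sum_const, nsmul_eq_mul, hA]
    push_cast
    ring
  rw [hdev]
  calc (∑ x ∈ A, (u x - α * q)) ^ 2
      ≤ #A * ∑ x ∈ A, (u x - α * q) ^ 2 := sq_sum_le_card_mul_sum_sq
    _ ≤ #A * ∑ x, (u x - α * q) ^ 2 := by
        gcongr
        exact subset_univ A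
    _ ≤ #A * (α * q ^ 3) := by gcongr
    _ = α ^ 2 * q ^ 5 := by rw [hA]; ring


/-- Counting parabolic progressions in `𝔽_q²`: if `|A| = α·q²`, then the number of triples
`(x, y, z)` with `(x, y) ∈ A` and `(x + z, y + z²) ∈ A` is at least `(α − q^{-1/2})·α·q³`. -/
theorem count_parabolic_progressions (p n : ℕ) (hp : p.Prime) (hodd : Odd p)
    (F : Type*) [Field F] [Fintype F] [DecidableEq F] (hcard : Fintype.card F = p ^ n)
    (A : Finset (F × F)) (α : ℝ) (hα0 : 0 ≤ α) (hα1 : α ≤ 1)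
    (hA : (A.card : ℝ) = α * (Fintype.card F : ℝ) ^ 2) :
    (α - (Fintype.card F : ℝ) ^ (-(1 : ℝ) / 2)) * α * (Fintype.card F : ℝ) ^ 3 ≤
      ((Finset.univ.filter fun t : F × F × F =>
          (t.1, t.2.1) ∈ A ∧ (t.1 + t.2.2, t.2.1 + t.2.2 ^ 2) ∈ A).card : ℝ) := by
  have h2 : (2 : F) ≠ 0 := by
    refine Ring.two_ne_zero fun h => ?_
    have h0 := FiniteField.even_card_iff_char_two.1 h
    have := Nat.odd_iff.1 (hodd.pow (n := n))
    omega
  have hN : (Finset.univ.filter fun t : F × F × F =>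
      (t.1, t.2.1) ∈ A ∧ (t.1 + t.2.2, t.2.1 + t.2.2 ^ 2) ∈ A).card =
      ∑ x ∈ A, (Finset.univ.filter fun z : F => x + (z, z ^ 2) ∈ A).card := by
    rw [← Finset.card_sigma]
    refine Finset.card_bij' (fun t _ => ⟨(t.1, t.2.1), t.2.2⟩)
      (fun s _ => (s.1.1, s.1.2, s.2)) ?_ ?_ ?_ ?_ <;> simp +contextual [Prod.add_def]
  have hsq := sq_sum_card_translates_sub_le (fun z : F => (z, z ^ 2))
    (fun z w z' w' h _ => parabola_sub_injective h2 z w z' w' h) A α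
    (by rw [Fintype.card_prod, sq]) hA
  rw [hN]
  have hq : (0 : ℝ) < Fintype.card F := by exact_mod_cast Fintype.card_pos
  set q : ℝ := (Fintype.card F : ℝ)
  have hr : (q ^ (-(1 : ℝ) / 2)) ^ 2 * q = 1 := by
    rw [← Real.rpow_natCast, ← Real.rpow_mul hq.le]
    norm_num [Real.rpow_neg_one, hq.ne']
  have hr0 : 0 ≤ q ^ (-(1 : ℝ) / 2) := by positivity
  set r : ℝ := q ^ (-(1 : ℝ) / 2)
  have hdev : |((∑ x ∈ A, (Finset.univ.filter fun z : F => x + (z, z ^ 2) ∈ A).card : ℕ) : ℝ) -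
      α ^ 2 * q ^ 3| ≤ r * α * q ^ 3 := by
    refine abs_le_of_sq_le_sq (hsq.trans_eq ?_) (by positivity)
    linear_combination (-α ^ 2 * q ^ 5) * hr
  linarith [(abs_le.1 hdev).1]
end
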